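/- arXiv:2506.01501 — 2 statements merged into one kernel-verified Lean document; each statement's English description precedes it below -/
import Mathlib

section
/- Let C be a category with finite coproducts satisfying condition 𝕄, and such that the hom-set between any pair of objects of C is non-empty. Then for any pair of objects a, b of C the following are equivalent: (i) a ≅ b; (ii) the n-fold coproduct of a with itself is isomorphic to the n-fold coproduct of b with itself, for some integer n > 0; (iii) a ⊔ c ≅ b ⊔ c for some object c of C. -/
open CategoryTheory

universe v u

/-- Morphisms in `C` admit epi-mono factorization: every morphism factors as an epimorphism
followed by a monomorphism, uniquely up to isomorphism. -/
def HasEpiMonoFactorization (C : Type u) [Category.{v} C] : Prop :=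
  ∀ ⦃a b : C⦄ (f : a ⟶ b), ∃ (m : C) (p : a ⟶ m) (i : m ⟶ b),
    Epi p ∧ Mono i ∧ p ≫ i = f ∧
      ∀ (m' : C) (p' : a ⟶ m') (i' : m' ⟶ b), Epi p' → Mono i' → p' ≫ i' = f →
        ∃ δ : m ≅ m', p ≫ δ.hom = p' ∧ δ.hom ≫ i' = i

/-- Condition 𝕄: `C` is locally finite, morphisms admit epi-mono factorization, and for every
object `c` the poset of subobjects of `c`, ordered by `d ≤ d'` iff there is a monomorphism
`d ⟶ d'`, is well-founded (with respect to the associated strict order). -/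
def ConditionM (C : Type u) [Category.{v} C] : Prop :=
  (∀ a b : C, Finite (a ⟶ b)) ∧ HasEpiMonoFactorization C ∧
    ∀ c : C, WellFounded (fun S T : Subobject c =>
      (∃ f : Subobject.underlying.obj S ⟶ Subobject.underlying.obj T, Mono f) ∧
        ¬ ∃ f : Subobject.underlying.obj T ⟶ Subobject.underlying.obj S, Mono f)

open CategoryTheory.Limits

/-- The `n`-fold coproduct of an object with itself. -/
noncomputable def coprodPow {C : Type u} [Category.{v} C] [HasFiniteCoproducts C]
    (a : C) : ℕ → C
  | 0 => ⊥_ C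
  | k + 1 => a ⨿ coprodPow a k

/-- Two epi-mono factorizations of the same morphism are isomorphic. -/
theorem HasEpiMonoFactorization.exists_iso {C : Type u} [Category.{v} C]
    (hF : HasEpiMonoFactorization C) {a b m m' : C} (p : a ⟶ m) (i : m ⟶ b) (p' : a ⟶ m')
    (i' : m' ⟶ b) [Epi p] [Mono i] [Epi p'] [Mono i'] (h : p ≫ i = p' ≫ i') :
    ∃ δ : m ≅ m', p ≫ δ.hom = p' ∧ δ.hom ≫ i' = i := by
  obtain ⟨k, q, j, _, _, _, hu⟩ := hF (p ≫ i)
  obtain ⟨δ, h1, h2⟩ := hu m p i inferInstance inferInstance rfl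
  obtain ⟨δ', h1', h2'⟩ := hu m' p' i' inferInstance inferInstance h.symm
  refine ⟨δ.symm ≪≫ δ', ?_, ?_⟩
  · simp [← h1, ← h1']
  · simp [h2', ← h2]

/-- If a composite with a monomorphism is epi, the monomorphism is an isomorphism. -/
theorem HasEpiMonoFactorization.isIso_of_epi_comp {C : Type u} [Category.{v} C]
    (hF : HasEpiMonoFactorization C) {a m b : C} (p : a ⟶ m) (i : m ⟶ b) [Epi p] [Mono i]
    [Epi (p ≫ i)] : IsIso i := by
  obtain ⟨δ, -, h⟩ := hF.exists_iso p i (p ≫ i) (𝟙 b) (by simp)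
  rw [← h, Category.comp_id]
  infer_instance

/-- A morphism that is not epi amounts to an epimorphism onto a proper subobject. -/
noncomputable def HasEpiMonoFactorization.sigmaEquivNotEpi {C : Type u} [Category.{v} C]
    (hF : HasEpiMonoFactorization C) (a d : C) :
    (Σ S : {S : Subobject d // ¬ IsIso S.arrow},
      {g : a ⟶ Subobject.underlying.obj S.1 // Epi g}) ≃ {f : a ⟶ d // ¬ Epi f} :=
  Equiv.ofBijective
    (fun x => ⟨x.2.1 ≫ x.1.1.arrow, fun h =>
      haveI := x.2.2
      x.1.2 (hF.isIso_of_epi_comp x.2.1 x.1.1.arrow)⟩) <| by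
    constructor
    · rintro ⟨⟨S, hS⟩, g, hg⟩ ⟨⟨T, hT⟩, k, hk⟩ h
      have h' : g ≫ S.arrow = k ≫ T.arrow := congrArg Subtype.val h
      obtain ⟨δ, -, hδ⟩ := hF.exists_iso g S.arrow k T.arrow h'
      obtain rfl : S = T := Subobject.eq_of_comm δ hδ
      obtain rfl : g = k := (cancel_mono S.arrow).1 h'
      rfl
    · rintro ⟨f, hf⟩
      obtain ⟨m, p, i, hp, hi, rfl, -⟩ := hF f
      refine ⟨⟨⟨Subobject.mk i, fun h => hf ?_⟩,
        p ≫ (Subobject.underlyingIso i).inv, inferInstance⟩, ?_⟩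
      · have : IsIso i := by
          rw [← Subobject.underlyingIso_arrow i]
          infer_instance
        infer_instance
      · simp

/-- An epic endomorphism of an object with finitely many endomorphisms is invertible. -/
theorem isIso_of_epi_of_finite_end {C : Type u} [Category.{v} C] {a : C} [Finite (a ⟶ a)]
    (e : a ⟶ a) [Epi e] : IsIso e := by
  obtain ⟨f, hf⟩ := Finite.surjective_of_injective
    (f := fun g : a ⟶ a => e ≫ g) (fun _ _ h => (cancel_epi e).1 h) (𝟙 a)
  exact ⟨f, hf, (cancel_epi e).1 (by simp [reassoc_of% hf])⟩

/-- A monic endomorphism of an object with finitely many endomorphisms is invertible. -/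
theorem isIso_of_mono_of_finite_end {C : Type u} [Category.{v} C] {a : C} [Finite (a ⟶ a)]
    (e : a ⟶ a) [Mono e] : IsIso e := by
  obtain ⟨f, hf⟩ := Finite.surjective_of_injective
    (f := fun g : a ⟶ a => g ≫ e) (fun _ _ h => (cancel_mono e).1 h) (𝟙 a)
  exact ⟨f, (cancel_mono e).1 (by simp [show f ≫ e = 𝟙 a from hf]), hf⟩

/-- Monomorphisms in both directions are isomorphisms when endomorphisms are finite in number. -/
theorem isIso_of_mono_of_mono {C : Type u} [Category.{v} C] {a b : C} [Finite (b ⟶ b)]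
    (i : a ⟶ b) (j : b ⟶ a) [Mono i] [Mono j] : IsIso i := by
  have := isIso_of_mono_of_finite_end (j ≫ i)
  have : IsSplitEpi i := ⟨⟨⟨inv (j ≫ i) ≫ j, by simp⟩⟩⟩
  exact isIso_of_mono_of_isSplitEpi i

/-- Epimorphisms in both directions are isomorphisms when endomorphisms are finite in number. -/
theorem isIso_of_epi_of_epi {C : Type u} [Category.{v} C] {a b : C} [Finite (a ⟶ a)]
    (p : a ⟶ b) (q : b ⟶ a) [Epi p] [Epi q] : IsIso p := by
  have := isIso_of_epi_of_finite_end (p ≫ q)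
  have : IsSplitMono p := ⟨⟨⟨q ≫ inv (p ≫ q), by rw [← Category.assoc, IsIso.hom_inv_id]⟩⟩⟩
  exact isIso_of_epi_of_isSplitMono p

/-- Under condition 𝕄, if `a` and `b` have equally many morphisms to every object, then they have
equally many epimorphisms to every object. -/
theorem ConditionM.card_epi_eq {C : Type u} [Category.{v} C] (hM : ConditionM C) {a b : C}
    (h : ∀ d : C, Nat.card (a ⟶ d) = Nat.card (b ⟶ d)) (c : C) :
    Nat.card {f : a ⟶ c // Epi f} = Nat.card {f : b ⟶ c // Epi f} := by
  obtain ⟨hfin, hF, hwf⟩ := hM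
  suffices H : ∀ (S : Subobject c) (d : C) (i : d ⟶ c) [Mono i], S = Subobject.mk i →
      Nat.card {f : a ⟶ d // Epi f} = Nat.card {f : b ⟶ d // Epi f} from H _ c (𝟙 c) rfl
  intro S
  induction S using (hwf c).induction with
  | _ S ih =>
  rintro d i _ rfl
  have hproper : ∀ T : {T : Subobject d // ¬ IsIso T.arrow},
      Nonempty ({g : a ⟶ Subobject.underlying.obj T.1 // Epi g} ≃
        {g : b ⟶ Subobject.underlying.obj T.1 // Epi g}) := by
    rintro ⟨T, hT⟩
    refine Finite.card_eq.1 (ih (Subobject.mk (T.arrow ≫ i)) ⟨?_, ?_⟩ _ _ rfl)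
    · exact ⟨(Subobject.underlyingIso (T.arrow ≫ i)).hom ≫ T.arrow ≫
        (Subobject.underlyingIso i).inv, inferInstance⟩
    · rintro ⟨g, hg⟩
      exact hT (isIso_of_mono_of_mono T.arrow ((Subobject.underlyingIso i).inv ≫ g ≫
        (Subobject.underlyingIso (T.arrow ≫ i)).hom))
  have hnot : Nat.card {f : a ⟶ d // ¬ Epi f} = Nat.card {f : b ⟶ d // ¬ Epi f} :=
    Nat.card_congr <| (hF.sigmaEquivNotEpi a d).symm.trans <|
      (Equiv.sigmaCongrRight fun T => (hproper T).some).trans (hF.sigmaEquivNotEpi b d)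
  have hsplit : ∀ x : C, Nat.card (x ⟶ d) =
      Nat.card {f : x ⟶ d // Epi f} + Nat.card {f : x ⟶ d // ¬ Epi f} := fun x => by
    classical
    rw [← Nat.card_sum, Nat.card_congr (Equiv.sumCompl (fun f : x ⟶ d => Epi f))]
  have := h d
  rw [hsplit, hsplit, hnot] at this
  exact Nat.add_right_cancel this

/-- Under condition 𝕄, an object is determined up to isomorphism by the numbers of morphisms
out of it. -/
theorem ConditionM.nonempty_iso_of_card_hom_eq {C : Type u} [Category.{v} C] (hM : ConditionM C)
    {a b : C} (h : ∀ d : C, Nat.card (a ⟶ d) = Nat.card (b ⟶ d)) : Nonempty (a ≅ b) := by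
  have := hM.1
  have exists_epi : ∀ {x y : C}, (∀ d : C, Nat.card (x ⟶ d) = Nat.card (y ⟶ d)) →
      ∃ p : x ⟶ y, Epi p := fun {x y} hxy => by
    have : Nonempty {f : y ⟶ y // Epi f} := ⟨⟨𝟙 y, inferInstance⟩⟩
    have hpos : 0 < Nat.card {f : x ⟶ y // Epi f} := by
      rw [hM.card_epi_eq hxy]
      exact Nat.card_pos
    obtain ⟨p, hp⟩ := (Nat.card_pos_iff.1 hpos).1
    exact ⟨p, hp⟩
  obtain ⟨p, _⟩ := exists_epi h
  obtain ⟨q, _⟩ := exists_epi fun d => (h d).symm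
  have := isIso_of_epi_of_epi p q
  exact ⟨asIso p⟩

theorem card_coprod_hom {C : Type u} [Category.{v} C] [HasFiniteCoproducts C] (a b d : C) :
    Nat.card (a ⨿ b ⟶ d) = Nat.card (a ⟶ d) * Nat.card (b ⟶ d) := by
  rw [← Nat.card_prod]
  exact Nat.card_congr
    { toFun f := (coprod.inl ≫ f, coprod.inr ≫ f)
      invFun f := coprod.desc f.1 f.2
      left_inv f := coprod.hom_ext (coprod.inl_desc _ _) (coprod.inr_desc _ _)
      right_inv f := Prod.ext (coprod.inl_desc _ _) (coprod.inr_desc _ _) }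

theorem card_coprodPow_hom {C : Type u} [Category.{v} C] [HasFiniteCoproducts C] (a d : C)
    (n : ℕ) : Nat.card (coprodPow a n ⟶ d) = Nat.card (a ⟶ d) ^ n := by
  induction n with
  | zero =>
    rw [pow_zero]
    exact Nat.card_unique (α := (⊥_ C) ⟶ d)
  | succ n ih =>
    rw [pow_succ', ← ih]
    exact card_coprod_hom a (coprodPow a n) d

theorem card_hom_congr_left {C : Type u} [Category.{v} C] {a b : C} (e : a ≅ b) (d : C) :
    Nat.card (a ⟶ d) = Nat.card (b ⟶ d) :=
  Nat.card_congr (e.homCongr (Iso.refl d))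

/-- In a cocartesian category satisfying condition 𝕄 in which all hom-sets
are non-empty, the following are equivalent for objects `a, b`: (i) `a ≅ b`; (ii) the `n`-fold
coproduct of `a` with itself is isomorphic to the `n`-fold coproduct of `b` with itself for
some `n > 0`; (iii) `a ⨿ c ≅ b ⨿ c` for some object `c`. -/
theorem coprod_cancellation (C : Type u) [Category.{v} C] [HasFiniteCoproducts C]
    (hM : ConditionM C) (hne : ∀ a b : C, Nonempty (a ⟶ b)) (a b : C) :
    List.TFAE
      [Nonempty (a ≅ b),
       ∃ n : ℕ, 0 < n ∧ Nonempty (coprodPow a n ≅ coprodPow b n),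
       ∃ c : C, Nonempty ((a ⨿ c) ≅ b ⨿ c)] := by
  have := hM.1
  tfae_have 1 → 2 := fun ⟨e⟩ => ⟨1, one_pos, ⟨coprod.mapIso e (Iso.refl (⊥_ C))⟩⟩
  tfae_have 1 → 3 := fun ⟨e⟩ => ⟨a, ⟨coprod.mapIso e (Iso.refl a)⟩⟩
  tfae_have 2 → 1 := fun ⟨n, hn, ⟨e⟩⟩ => hM.nonempty_iso_of_card_hom_eq fun d => by
    have h := card_hom_congr_left e d
    rw [card_coprodPow_hom, card_coprodPow_hom] at h
    exact Nat.pow_left_injective hn.ne' h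
  tfae_have 3 → 1 := fun ⟨c, ⟨e⟩⟩ => hM.nonempty_iso_of_card_hom_eq fun d => by
    have h := card_hom_congr_left e d
    rw [card_coprod_hom, card_coprod_hom] at h
    have := hne c d
    exact Nat.eq_of_mul_eq_mul_right Nat.card_pos h
  tfae_finish
end

section
/- Let C be a category with finite products satisfying condition 𝔼, and such that the hom-set between any pair of objects of C is non-empty. Then for any pair of objects a, b of C the following are equivalent: (i) a ≅ b; (ii) the n-fold product of a with itself is isomorphic to the n-fold product of b with itself, for some integer n > 0; (iii) a × c ≅ b × c for some object c of C. -/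
open CategoryTheory

universe v u

/-- Condition 𝔼: `C` is locally finite, morphisms admit epi-mono factorization, and for every
object `c` the poset of quotients of `c` (subobjects of `c` in the opposite category), ordered
by `d ≤ d'` iff there is an epimorphism `d' ⟶ d`, is well-founded (with respect to the
associated strict order). -/
def ConditionE (C : Type u) [Category.{v} C] : Prop :=
  (∀ a b : C, Finite (a ⟶ b)) ∧ HasEpiMonoFactorization C ∧
    ∀ c : C, WellFounded (fun S T : Subobject (Opposite.op c) =>
      (∃ f : (Subobject.underlying.obj T).unop ⟶ (Subobject.underlying.obj S).unop, Epi f) ∧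
        ¬ ∃ f : (Subobject.underlying.obj S).unop ⟶ (Subobject.underlying.obj T).unop, Epi f)

open CategoryTheory.Limits

/-- The `n`-fold product of an object with itself. -/
noncomputable def prodPow {C : Type u} [Category.{v} C] [HasFiniteProducts C]
    (a : C) : ℕ → C
  | 0 => ⊤_ C
  | k + 1 => a ⨯ prodPow a k

section Counting

variable {C : Type u} [Category.{v} C]

/-- In a finite monoid of endomorphisms, epimorphisms are invertible. -/
theorem isIso_of_epi_endo {x : C} [Finite (x ⟶ x)] (e : x ⟶ x) [Epi e] : IsIso e := by
  have hinj : Function.Injective (fun f : x ⟶ x => e ≫ f) := fun f g h => (cancel_epi e).1 h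
  obtain ⟨g, hg⟩ := Finite.surjective_of_injective hinj (𝟙 x)
  have hg : e ≫ g = 𝟙 x := hg
  exact ⟨g, hg, by rw [← cancel_epi e, reassoc_of% hg, Category.comp_id]⟩

/-- In a finite monoid of endomorphisms, monomorphisms are invertible. -/
theorem isIso_of_mono_endo {x : C} [Finite (x ⟶ x)] (e : x ⟶ x) [Mono e] : IsIso e := by
  have hinj : Function.Injective (fun f : x ⟶ x => f ≫ e) := fun f g h => (cancel_mono e).1 h
  obtain ⟨g, hg⟩ := Finite.surjective_of_injective hinj (𝟙 x)
  have hg : g ≫ e = 𝟙 x := hg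
  exact ⟨g, by rw [← cancel_mono e, Category.assoc, hg, Category.comp_id, Category.id_comp], hg⟩

theorem isIso_of_epi_of_epi_back {x y : C} [Finite (x ⟶ x)] (p : x ⟶ y) (q : y ⟶ x)
    [Epi p] [Epi q] : IsIso p := by
  have := isIso_of_epi_endo (p ≫ q)
  have : IsSplitMono p := IsSplitMono.mk' ⟨q ≫ inv (p ≫ q), by
    rw [← Category.assoc, IsIso.hom_inv_id]⟩
  exact isIso_of_epi_of_isSplitMono p

theorem nonempty_iso_of_mono_of_mono {x y : C} [Finite (y ⟶ y)] (i : x ⟶ y) (j : y ⟶ x)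
    [Mono i] [Mono j] : Nonempty (x ≅ y) := by
  have := isIso_of_mono_endo (j ≫ i)
  have : IsSplitEpi i := IsSplitEpi.mk' ⟨inv (j ≫ i) ≫ j, by
    rw [Category.assoc, IsIso.inv_hom_id]⟩
  have := isIso_of_mono_of_isSplitEpi i
  exact ⟨asIso i⟩

theorem HasEpiMonoFactorization.isIso_of_epi_of_mono (hF : HasEpiMonoFactorization C)
    {x y : C} (p : x ⟶ y) [Epi p] [Mono p] : IsIso p := by
  obtain ⟨m, q, i, _, _, _, h⟩ := hF p
  obtain ⟨δ, -, hδ'⟩ := h x (𝟙 x) p inferInstance inferInstance (Category.id_comp p)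
  obtain ⟨ε, -, hε'⟩ := h y p (𝟙 y) inferInstance inferInstance (Category.comp_id p)
  rw [Category.comp_id] at hε'
  have : IsIso i := hε' ▸ inferInstance
  have : p = δ.inv ≫ i := by rw [← hδ', Iso.inv_hom_id_assoc]
  rw [this]
  infer_instance

theorem HasEpiMonoFactorization.exists_iso_s14 (hF : HasEpiMonoFactorization C)
    {x y m n : C} (p : x ⟶ m) (i : m ⟶ y) (q : x ⟶ n) (j : n ⟶ y) [Epi p] [Mono i] [Epi q]
    [Mono j] (h : p ≫ i = q ≫ j) : ∃ δ : m ≅ n, p ≫ δ.hom = q := by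
  obtain ⟨_, r, k, _, _, _, H⟩ := hF (p ≫ i)
  obtain ⟨δ, hδ, _⟩ := H m p i inferInstance inferInstance rfl
  obtain ⟨ε, hε, _⟩ := H n q j inferInstance inferInstance h.symm
  exact ⟨δ.symm ≪≫ ε, by simp [← hδ, hε]⟩

/-- The object of a quotient of `x`. -/
noncomputable abbrev quotObj {x : C} (S : Subobject (Opposite.op x)) : C :=
  (Subobject.underlying.obj S).unop

/-- The projection of `x` onto one of its quotients. -/
noncomputable abbrev quotProj {x : C} (S : Subobject (Opposite.op x)) : x ⟶ quotObj S :=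
  S.arrow.unop

theorem exists_quot {x y : C} (p : x ⟶ y) [Epi p] :
    ∃ (S : Subobject (Opposite.op x)) (e : y ≅ quotObj S), p ≫ e.hom = quotProj S := by
  refine ⟨Subobject.mk p.op, (Subobject.underlyingIso p.op).unop, ?_⟩
  apply Quiver.Hom.op_inj
  simp [quotProj]

theorem quot_ext {x : C} {S T : Subobject (Opposite.op x)} (δ : quotObj S ≅ quotObj T)
    (h : quotProj S ≫ δ.hom = quotProj T) : S = T := by
  refine Subobject.eq_of_comm δ.op.symm ?_
  have h' : T.arrow = δ.hom.op ≫ S.arrow := congrArg Quiver.Hom.op h.symm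
  simp [h', ← op_comp_assoc]

/-- Non-monomorphisms out of `x` correspond to monomorphisms out of proper quotients of `x`. -/
theorem HasEpiMonoFactorization.nonempty_equiv_not_mono (hF : HasEpiMonoFactorization C)
    (x a : C) :
    Nonempty ((Σ S : {S : Subobject (Opposite.op x) // ¬ IsIso (quotProj S)},
      {i : quotObj S.1 ⟶ a // Mono i}) ≃ {f : x ⟶ a // ¬ Mono f}) := by
  refine ⟨Equiv.ofBijective (fun t => ⟨quotProj t.1.1 ≫ t.2.1, fun h => ?_⟩) ⟨?_, ?_⟩⟩
  · have := mono_of_mono (quotProj t.1.1) t.2.1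
    exact t.1.2 (hF.isIso_of_epi_of_mono _)
  · rintro ⟨⟨S, hS⟩, ⟨i, hi⟩⟩ ⟨⟨T, hT⟩, ⟨j, hj⟩⟩ h
    have h : quotProj S ≫ i = quotProj T ≫ j := congrArg Subtype.val h
    obtain ⟨δ, hδ⟩ := hF.exists_iso_s14 _ _ _ _ h
    obtain rfl := quot_ext δ hδ
    obtain rfl := (cancel_epi _).1 h
    rfl
  · rintro ⟨f, hf⟩
    obtain ⟨m, p, i, _, _, hpi, -⟩ := hF f
    obtain ⟨S, e, he⟩ := exists_quot p
    refine ⟨⟨⟨S, fun hS => hf ?_⟩, ⟨e.inv ≫ i, inferInstance⟩⟩, Subtype.ext ?_⟩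
    · have : f = quotProj S ≫ e.inv ≫ i := by simp [← he, hpi]
      rw [this]
      infer_instance
    · simp [← he, hpi]

/-- Induction along proper quotients. -/
theorem ConditionE.induction (hE : ConditionE C) {P : C → Prop}
    (ind : ∀ x, (∀ y (p : x ⟶ y), Epi p → ¬ IsIso p → P y) → P x) (x : C) : P x := by
  have key : ∀ (S : Subobject (Opposite.op x)) (y : C), (y ≅ quotObj S) → P y := by
    intro S
    induction S using (hE.2.2 x).induction with
    | _ S ih =>
      intro y e
      refine ind y fun z p _ hp => ?_
      obtain ⟨T, e', _⟩ := exists_quot (quotProj S ≫ e.inv ≫ p)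
      refine ih T ⟨⟨e.inv ≫ p ≫ e'.hom, inferInstance⟩, ?_⟩ z e'
      rintro ⟨q, hq⟩
      have : Epi q := hq
      have := hE.1 y y
      exact hp (isIso_of_epi_of_epi_back p (e'.hom ≫ q ≫ e.inv))
  obtain ⟨S, e, -⟩ := exists_quot (𝟙 x)
  exact key S x e

/-- Lovász's theorem: objects receiving equally many morphisms from every object are
isomorphic. -/
theorem ConditionE.nonempty_iso (hE : ConditionE C) {a b : C}
    (h : ∀ x : C, Nat.card (x ⟶ a) = Nat.card (x ⟶ b)) : Nonempty (a ≅ b) := by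
  have := hE.1
  have key : ∀ x : C, Nonempty ({i : x ⟶ a // Mono i} ≃ {i : x ⟶ b // Mono i}) := by
    refine hE.induction fun x ih => ?_
    obtain ⟨ea⟩ := hE.2.1.nonempty_equiv_not_mono x a
    obtain ⟨eb⟩ := hE.2.1.nonempty_equiv_not_mono x b
    have hrest := Nat.card_congr ((ea.symm.trans (Equiv.sigmaCongrRight fun S =>
      (ih (quotObj S.1) (quotProj S.1) inferInstance S.2).some)).trans eb)
    have split : ∀ c : C, Nat.card (x ⟶ c) =
        Nat.card {i : x ⟶ c // Mono i} + Nat.card {i : x ⟶ c // ¬ Mono i} := by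
      classical
      intro c
      rw [← Nat.card_sum, Nat.card_congr (Equiv.sumCompl fun i : x ⟶ c => Mono i)]
    have := h x
    rw [split a, split b, hrest] at this
    exact Finite.card_eq.mp (Nat.add_right_cancel this)
  obtain ⟨i, _⟩ := (key a).some ⟨𝟙 a, inferInstance⟩
  obtain ⟨j, _⟩ := (key b).some.symm ⟨𝟙 b, inferInstance⟩
  exact nonempty_iso_of_mono_of_mono i j

theorem card_hom_congr {a b : C} (e : a ≅ b) (x : C) :
    Nat.card (x ⟶ a) = Nat.card (x ⟶ b) :=
  Nat.card_congr ((Iso.refl x).homCongr e)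

theorem card_hom_prod [HasFiniteProducts C] (x a b : C) :
    Nat.card (x ⟶ a ⨯ b) = Nat.card (x ⟶ a) * Nat.card (x ⟶ b) := by
  rw [← Nat.card_prod]
  exact Nat.card_congr
    { toFun := fun f => (f ≫ prod.fst, f ≫ prod.snd)
      invFun := fun f => prod.lift f.1 f.2
      left_inv := fun f => Limits.prod.hom_ext (prod.lift_fst _ _) (prod.lift_snd _ _)
      right_inv := fun f => Prod.ext (prod.lift_fst _ _) (prod.lift_snd _ _) }

theorem card_hom_prodPow [HasFiniteProducts C] (x a : C) (n : ℕ) :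
    Nat.card (x ⟶ prodPow a n) = Nat.card (x ⟶ a) ^ n := by
  induction n with
  | zero =>
    rw [prodPow, pow_zero, Nat.card_unique]
  | succ n ih => rw [prodPow, card_hom_prod, ih, pow_succ']

end Counting

/-- In a cartesian category satisfying condition 𝔼 in which all hom-sets
are non-empty, the following are equivalent for objects `a, b`: (i) `a ≅ b`; (ii) the `n`-fold
product of `a` with itself is isomorphic to the `n`-fold product of `b` with itself for some
`n > 0`; (iii) `a ⨯ c ≅ b ⨯ c` for some object `c`. -/
theorem prod_cancellation (C : Type u) [Category.{v} C] [HasFiniteProducts C]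
    (hE : ConditionE C) (hne : ∀ a b : C, Nonempty (a ⟶ b)) (a b : C) :
    List.TFAE
      [Nonempty (a ≅ b),
       ∃ n : ℕ, 0 < n ∧ Nonempty (prodPow a n ≅ prodPow b n),
       ∃ c : C, Nonempty ((a ⨯ c) ≅ b ⨯ c)] := by
  have := hE.1
  tfae_have 1 → 2 := fun ⟨e⟩ => ⟨1, one_pos, ⟨prod.mapIso e (Iso.refl _)⟩⟩
  tfae_have 1 → 3 := fun ⟨e⟩ => ⟨a, ⟨prod.mapIso e (Iso.refl _)⟩⟩
  tfae_have 2 → 1 := fun ⟨n, hn, ⟨e⟩⟩ => hE.nonempty_iso fun x => by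
    have h := card_hom_congr e x
    rw [card_hom_prodPow, card_hom_prodPow] at h
    exact Nat.pow_left_injective hn.ne' h
  tfae_have 3 → 1 := fun ⟨c, ⟨e⟩⟩ => hE.nonempty_iso fun x => by
    have h := card_hom_congr e x
    rw [card_hom_prod, card_hom_prod] at h
    have := hne x c
    exact Nat.eq_of_mul_eq_mul_right Nat.card_pos h
  tfae_finish
end
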